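/- arXiv:0910.3253 — 3 statements merged into one kernel-verified Lean document; each statement's English description precedes it below -/
import Mathlib

section
/- For any assignment of values in ZMod 2 to the singleton and doubleton subsets of Ω (i.e., for any f: Ω → ZMod 2 and any symmetric g defined on pairs of distinct elements of Ω with values in ZMod 2), there exists a unique grade-2 additive map φ: 𝒜 → ZMod 2 with φ({ω}) = f(ω) for all ω ∈ Ω and φ({ω,ω'}) = g(ω,ω') for all distinct ω,ω' ∈ Ω. -/
/-- `φ : 𝒜 → ZMod 2` is grade-2 additive:
`φ(A ∪ B ∪ C) = φ(A∪B) + φ(A∪C) + φ(B∪C) + φ(A) + φ(B) + φ(C)`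
for all mutually disjoint `A, B, C`. -/
def Grade2Additive {Ω : Type*} [DecidableEq Ω] (φ : Finset Ω → ZMod 2) : Prop :=
  ∀ A B C : Finset Ω, Disjoint A B → Disjoint A C → Disjoint B C →
    φ (A ∪ B ∪ C) = φ (A ∪ B) + φ (A ∪ C) + φ (B ∪ C) + φ A + φ B + φ C

namespace Grade2Additive

variable {Ω : Type*} [DecidableEq Ω]

theorem map_empty {φ : Finset Ω → ZMod 2} (hφ : Grade2Additive φ) : φ ∅ = 0 := by
  have h := hφ ∅ ∅ ∅ (by simp) (by simp) (by simp)
  have h2 : (2 : ZMod 2) = 0 := by decide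
  simp only [Finset.union_empty] at h
  linear_combination h + 3 * φ ∅ * h2

/-- The diagonal of a bi-additive set function is grade-2 additive. -/
theorem sum_sum (q : Ω → Ω → ZMod 2) :
    Grade2Additive fun A : Finset Ω => ∑ a ∈ A, ∑ b ∈ A, q a b := by
  intro A B C hAB hAC hBC
  have hABC : Disjoint (A ∪ B) C := Finset.disjoint_union_left.2 ⟨hAC, hBC⟩
  have h2 : (2 : ZMod 2) = 0 := by decide
  simp only [Finset.sum_union hABC, Finset.sum_union hAB, Finset.sum_union hAC,
    Finset.sum_union hBC, Finset.sum_add_distrib]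
  linear_combination (-(∑ a ∈ A, ∑ b ∈ A, q a b) - (∑ a ∈ B, ∑ b ∈ B, q a b)
    - ∑ a ∈ C, ∑ b ∈ C, q a b) * h2

/-- A grade-2 additive map is determined by its values on singletons and doubletons. -/
theorem eq_of_singleton_of_pair {φ ψ : Finset Ω → ZMod 2} (hφ : Grade2Additive φ)
    (hψ : Grade2Additive ψ) (h₁ : ∀ a, φ {a} = ψ {a})
    (h₂ : ∀ a b, a ≠ b → φ {a, b} = ψ {a, b}) : φ = ψ := by
  have key : ∀ S : Finset Ω, φ S = ψ S ∧ ∀ a ∉ S, φ (insert a S) = ψ (insert a S) := by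
    intro S
    induction S using Finset.induction_on with
    | empty => exact ⟨by rw [hφ.map_empty, hψ.map_empty], fun a _ => by simpa using h₁ a⟩
    | insert b T hb ih =>
      refine ⟨ih.2 b hb, fun a ha => ?_⟩
      obtain ⟨hab, haT⟩ : a ≠ b ∧ a ∉ T := by simpa using ha
      have hunion : insert a (insert b T) = {a} ∪ {b} ∪ T := by
        ext; simp
      have hpair : ({a} ∪ {b} : Finset Ω) = {a, b} := rfl
      have hd₁ : Disjoint ({a} : Finset Ω) {b} := by simpa using hab
      have hd₂ : Disjoint ({a} : Finset Ω) T := by simpa using haT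
      have hd₃ : Disjoint ({b} : Finset Ω) T := by simpa using hb
      rw [hunion, hφ _ _ _ hd₁ hd₂ hd₃, hψ _ _ _ hd₁ hd₂ hd₃, hpair,
        ← Finset.insert_eq a T, ← Finset.insert_eq b T, h₁, h₁, h₂ a b hab, ih.1,
        ih.2 a haT, ih.2 b hb]
  exact funext fun S => (key S).1

end Grade2Additive

/-- For any assignment of values in `ZMod 2` to the singleton and doubleton subsets
of `Ω` (a function `f` on elements and a symmetric function `g` on pairs of distinct
elements), there is a unique grade-2 additive `φ` taking those values. -/
theorem statement_6 {Ω : Type*} [Fintype Ω] [DecidableEq Ω]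
    (f : Ω → ZMod 2) (g : Ω → Ω → ZMod 2) (hg : ∀ ω ω', g ω ω' = g ω' ω) :
    ∃! φ : Finset Ω → ZMod 2, Grade2Additive φ ∧
      (∀ ω : Ω, φ {ω} = f ω) ∧
      (∀ ω ω' : Ω, ω ≠ ω' → φ {ω, ω'} = g ω ω') := by
  have h2 : (2 : ZMod 2) = 0 := by decide
  let e := Fintype.equivFin Ω
  let q : Ω → Ω → ZMod 2 := fun a b =>
    if a = b then f a else if e a < e b then g a b + f a + f b else 0
  have hq₁ (a : Ω) : q a a = f a := by simp [q]
  have hq₂ (a b : Ω) (hab : a ≠ b) : q a b + q b a = g a b + f a + f b := by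
    rcases lt_or_gt_of_ne (e.injective.ne hab) with h | h
    · simp [q, hab, hab.symm, h, h.not_gt]
    · simp only [q, hab, hab.symm, h, h.not_gt, if_true, if_false, hg b a]
      ring
  refine ⟨fun A => ∑ a ∈ A, ∑ b ∈ A, q a b,
    ⟨Grade2Additive.sum_sum q, fun a => by simp [hq₁], fun a b hab => ?_⟩, ?_⟩
  · simp only [Finset.sum_pair hab, hq₁]
    linear_combination hq₂ a b hab + (f a + f b) * h2
  · rintro ψ ⟨hψ, hψ₁, hψ₂⟩
    refine hψ.eq_of_singleton_of_pair (Grade2Additive.sum_sum q)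
      (fun a => by simp [hq₁, hψ₁]) fun a b hab => ?_
    simp only [Finset.sum_pair hab, hq₁, hψ₂ a b hab]
    linear_combination -hq₂ a b hab - (f a + f b) * h2
end

section
/- A map φ: 𝒜 → ZMod 2 is grade-2 additive if and only if there exists a grade-1 additive map λ: 2^(Ω×Ω) → ZMod 2 (i.e., λ(X+Y) = λ(X)+λ(Y) for all subsets X,Y of Ω×Ω, with + denoting symmetric difference) such that φ(A) = λ(A × A) for all A ∈ 𝒜. -/
/-- Summing a `ZMod 2`-valued weight over a symmetric difference is additive. -/
lemma sum_symmDiff_zmod_two {α : Type*} [DecidableEq α] (w : α → ZMod 2) (X Y : Finset α) :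
    ∑ p ∈ symmDiff X Y, w p = ∑ p ∈ X, w p + ∑ p ∈ Y, w p := by
  have hdisj : Disjoint (X \ Y) (Y \ X) :=
    disjoint_sdiff_sdiff
  have hX := Finset.sum_inter_add_sum_sdiff X Y w
  have hY := Finset.sum_inter_add_sum_sdiff Y X w
  rw [Finset.inter_comm] at hY
  rw [symmDiff_def, Finset.sup_eq_union, Finset.sum_union hdisj, ← hX, ← hY]
  linear_combination -(∑ p ∈ X ∩ Y, w p) * (CharTwo.two_eq_zero : (2 : ZMod 2) = 0)

/-- A map additive over symmetric differences is the sum of its values on singletons. -/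
lemma eq_sum_singleton_of_map_symmDiff {α : Type*} [DecidableEq α] {f : Finset α → ZMod 2}
    (hf : ∀ X Y : Finset α, f (symmDiff X Y) = f X + f Y) (X : Finset α) :
    f X = ∑ p ∈ X, f {p} := by
  induction X using Finset.induction_on with
  | empty => simpa using hf ∅ ∅
  | insert a s ha ih =>
    have hdisj : Disjoint ({a} : Finset α) s := Finset.disjoint_singleton_left.2 ha
    rw [Finset.sum_insert ha, ← ih, ← hf, hdisj.symmDiff_eq_sup, Finset.sup_eq_union,
      Finset.insert_eq]

/-- The diagonal restriction of a weight on ordered pairs is grade-2 additive. -/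
lemma grade2Additive_sum_product {Ω : Type*} [DecidableEq Ω] (w : Ω × Ω → ZMod 2) :
    Grade2Additive fun A => ∑ p ∈ A ×ˢ A, w p := by
  intro A B C hAB hAC hBC
  have hABC : Disjoint (A ∪ B) C := Finset.disjoint_union_left.2 ⟨hAC, hBC⟩
  simp only [Finset.sum_product, Finset.sum_union hABC, Finset.sum_union hAB,
    Finset.sum_union hAC, Finset.sum_union hBC, Finset.sum_add_distrib]
  linear_combination -(∑ a ∈ A, ∑ b ∈ A, w (a, b) + ∑ a ∈ B, ∑ b ∈ B, w (a, b) +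
    ∑ a ∈ C, ∑ b ∈ C, w (a, b)) * (CharTwo.two_eq_zero : (2 : ZMod 2) = 0)

namespace Grade2Additive

variable {Ω : Type*} [DecidableEq Ω] {φ : Finset Ω → ZMod 2}

lemma map_empty_s10 (h : Grade2Additive φ) : φ ∅ = 0 := by
  have h0 := h ∅ ∅ ∅ (by simp) (by simp) (by simp)
  simp only [Finset.union_self] at h0
  linear_combination h0 + 3 * φ ∅ * (CharTwo.two_eq_zero : (2 : ZMod 2) = 0)

/-- Adding a point changes `φ` by its value there plus its pairwise interferences. -/
lemma map_insert (h : Grade2Additive φ) {x : Ω} {A : Finset Ω} (hx : x ∉ A) :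
    φ (insert x A) = φ A + φ {x} + ∑ a ∈ A, (φ {x, a} + φ {x} + φ {a}) := by
  induction A using Finset.induction_on with
  | empty => simp [h.map_empty_s10]
  | insert a s ha ih =>
    have hxa : x ≠ a := fun e => hx (e ▸ Finset.mem_insert_self _ _)
    have hxs : x ∉ s := fun e => hx (Finset.mem_insert_of_mem e)
    have h3 := h {x} {a} s (by simpa using hxa) (by simpa using hxs) (by simpa using ha)
    rw [Finset.union_assoc] at h3
    simp only [← Finset.insert_eq] at h3
    rw [Finset.sum_insert ha, h3, ih hxs]
    linear_combination (φ s) * (CharTwo.two_eq_zero : (2 : ZMod 2) = 0)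

/-- A grade-2 additive map is the diagonal restriction of a weight on ordered pairs. -/
lemma exists_eq_sum_product (h : Grade2Additive φ) :
    ∃ w : Ω × Ω → ZMod 2, ∀ A : Finset Ω, φ A = ∑ p ∈ A ×ˢ A, w p := by
  let r : Ω → Ω → Prop := WellOrderingRel
  classical
  let w : Ω × Ω → ZMod 2 := fun p =>
    if p.1 = p.2 then φ {p.1} else if r p.1 p.2 then φ {p.1, p.2} + φ {p.1} + φ {p.2} else 0
  have hdiag (x : Ω) : w (x, x) = φ {x} := by simp [w]
  have hoff {x a : Ω} (hxa : x ≠ a) : w (x, a) + w (a, x) = φ {x, a} + φ {x} + φ {a} := by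
    rcases trichotomous_of r x a with hr | hr | hr
    · have hr' : ¬ r a x := asymm_of r hr
      simp [w, hxa, hxa.symm, hr, hr']
    · exact absurd hr hxa
    · have hr' : ¬ r x a := asymm_of r hr
      simp [w, hxa, hxa.symm, hr, hr', Finset.pair_comm a x]
      ring
  refine ⟨w, fun A => ?_⟩
  induction A using Finset.induction_on with
  | empty => simpa using h.map_empty_s10
  | insert x s hx ih =>
    have hsum : ∑ a ∈ s, (φ {x, a} + φ {x} + φ {a}) = ∑ a ∈ s, (w (x, a) + w (a, x)) :=
      Finset.sum_congr rfl fun a ha => (hoff (ne_of_mem_of_not_mem ha hx).symm).symm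
    rw [h.map_insert hx, hsum, ih, ← hdiag]
    simp only [Finset.sum_product, Finset.sum_insert hx, Finset.sum_add_distrib]
    ring

end Grade2Additive

/-- `φ : 𝒜 → ZMod 2` is grade-2 additive iff there is a grade-1 additive map
`λ : 2^(Ω×Ω) → ZMod 2` (additive over symmetric differences) with
`φ(A) = λ(A × A)` for all `A ∈ 𝒜`. -/
theorem statement_10 {Ω : Type*} [Fintype Ω] [DecidableEq Ω]
    (φ : Finset Ω → ZMod 2) :
    Grade2Additive φ ↔
      ∃ lam : Finset (Ω × Ω) → ZMod 2,
        (∀ X Y : Finset (Ω × Ω), lam (symmDiff X Y) = lam X + lam Y) ∧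
        ∀ A : Finset Ω, φ A = lam (A ×ˢ A) := by
  constructor
  · intro h
    obtain ⟨w, hw⟩ := h.exists_eq_sum_product
    exact ⟨fun X => ∑ p ∈ X, w p, sum_symmDiff_zmod_two w, hw⟩
  · rintro ⟨lam, hadd, hφ⟩
    have hsum : φ = fun A => ∑ p ∈ A ×ˢ A, lam {p} :=
      funext fun A => (hφ A).trans (eq_sum_singleton_of_map_symmDiff hadd _)
    rw [hsum]
    exact grade2Additive_sum_product fun p => lam {p}
end

section
/- The master observable satisfies: (a) P(A ∪ B) = P(A) + P(B) + P(A)P(B) for all A,B ∈ 𝒜; (b) P(Ω) is the identity map on 𝒜^*; (d) P is grade-2 additive: P(A ∪ B ∪ C) = P(A∪B) + P(A∪C) + P(B∪C) + P(A) + P(B) + P(C) for all mutually disjoint A,B,C ∈ 𝒜. -/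
/-- The projection `P(ω)` on coevents.  On the basis
`{ω_i^*} ∪ {ω_i^*ω_j^*}` of `𝒜^*` it is given by `P(ω)ω^* = ω^*`,
`P(ω)ω_j^* = ω^*ω_j^*` (`ω_j ≠ ω`), `P(ω)(ω^*ω_j^*) = ω^*ω_j^*` and
`P(ω)(ω_j^*ω_k^*) = 0` for `ω, ω_j, ω_k` distinct; for a coevent
`φ = Σ a_i ω_i^* + Σ b_{ij} ω_i^*ω_j^*` this action is equivalently given by the
intrinsic formula
`(P(ω)φ)(A) = φ({ω}) + Σ_{j ∈ A, j ≠ ω} (φ({ω,j}) + φ({ω}))` if `ω ∈ A`, else `0`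
(noting `a_ω = φ({ω})` and `a_j + b_{ωj} = φ({ω,j}) + φ({ω})`). -/
def Pw {Ω : Type*} [DecidableEq Ω] (ω : Ω) (φ : Finset Ω → ZMod 2) :
    Finset Ω → ZMod 2 := fun A =>
  if ω ∈ A then φ {ω} + ∑ j ∈ A.erase ω, (φ {ω, j} + φ {ω}) else 0

/-- The master observable
`P(A) = Σ_{ω ∈ A} P(ω) + Σ_{ω_i, ω_j ∈ A, i < j} P(ω_i)P(ω_j)`
(sums of compositions; `P(∅) = 0`). -/
def masterObservable {Ω : Type*} [LinearOrder Ω] (A : Finset Ω)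
    (φ : Finset Ω → ZMod 2) : Finset Ω → ZMod 2 :=
  (∑ ω ∈ A, Pw ω φ) +
    ∑ p ∈ (A ×ˢ A).filter (fun p => p.1 < p.2), Pw p.1 (Pw p.2 φ)

namespace Grade2Additive

variable {Ω : Type*} [DecidableEq Ω] {φ ψ : Finset Ω → ZMod 2}

theorem zero : Grade2Additive (0 : Finset Ω → ZMod 2) := by
  intro A B C _ _ _
  simp

theorem add (hφ : Grade2Additive φ) (hψ : Grade2Additive ψ) : Grade2Additive (φ + ψ) := by
  intro A B C hAB hAC hBC
  simp only [Pi.add_apply, hφ A B C hAB hAC hBC, hψ A B C hAB hAC hBC]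
  ring

theorem sum {ι : Type*} (s : Finset ι) {f : ι → Finset Ω → ZMod 2}
    (hf : ∀ i ∈ s, Grade2Additive (f i)) : Grade2Additive (∑ i ∈ s, f i) :=
  Finset.sum_induction f Grade2Additive (fun _ _ => add) zero hf

/-- The pointwise product of two additive set functions is grade-2 additive. -/
theorem sum_mul_sum (u v : Ω → ZMod 2) :
    Grade2Additive fun A => (∑ j ∈ A, u j) * ∑ j ∈ A, v j := by
  intro A B C hAB hAC hBC
  have hABC : Disjoint (A ∪ B) C := Finset.disjoint_union_left.2 ⟨hAC, hBC⟩
  simp only [Finset.sum_union hABC, Finset.sum_union hAB, Finset.sum_union hAC,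
    Finset.sum_union hBC]
  have two : (2 : ZMod 2) = 0 := by decide
  linear_combination (-((∑ j ∈ A, u j) * ∑ j ∈ A, v j) - (∑ j ∈ B, u j) * (∑ j ∈ B, v j) -
    (∑ j ∈ C, u j) * ∑ j ∈ C, v j) * two

/-- A coevent is determined by its values on sets with at most two elements. -/
theorem ext_of_card_le_two (hφ : Grade2Additive φ) (hψ : Grade2Additive ψ)
    (h : ∀ S : Finset Ω, S.card ≤ 2 → φ S = ψ S) : φ = ψ := by
  funext S
  induction S using Finset.strongInduction with
  | H S ih =>
    by_cases hS : S.card ≤ 2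
    · exact h S hS
    obtain ⟨x, y, hx, hy, hxy⟩ := Finset.one_lt_card_iff.1 (show 1 < S.card by omega)
    obtain ⟨z, hz⟩ : ((S.erase x).erase y).Nonempty := by
      rw [← Finset.card_pos, Finset.card_erase_of_mem (by simp [hy, hxy.symm]),
        Finset.card_erase_of_mem hx]
      omega
    set C := (S.erase x).erase y with hC
    have hxC : x ∉ C := by simp [hC]
    have hyC : y ∉ C := by simp [hC]
    have hzS : z ∈ S := Finset.mem_of_mem_erase (Finset.mem_of_mem_erase hz)
    have hCS : C ⊆ S := (Finset.erase_subset _ _).trans (Finset.erase_subset _ _)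
    have hdec : S = {x} ∪ {y} ∪ C := by
      ext w
      simp only [hC, Finset.mem_union, Finset.mem_singleton, Finset.mem_erase]
      by_cases hwx : w = x <;> by_cases hwy : w = y <;> simp_all
    have smaller : ∀ T : Finset Ω, T ⊆ S → (∃ w ∈ S, w ∉ T) → φ T = ψ T :=
      fun T hT ⟨w, hw, hwT⟩ => ih T (Finset.ssubset_iff_subset_ne.2 ⟨hT, fun e => hwT (e ▸ hw)⟩)
    have hzx : z ≠ x := fun e => hxC (e ▸ hz)
    have hzy : z ≠ y := fun e => hyC (e ▸ hz)
    have hxS : {x} ⊆ S := Finset.singleton_subset_iff.2 hx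
    have hyS : {y} ⊆ S := Finset.singleton_subset_iff.2 hy
    have dxy : Disjoint ({x} : Finset Ω) {y} := Finset.disjoint_singleton.2 hxy
    have dxC : Disjoint {x} C := Finset.disjoint_singleton_left.2 hxC
    have dyC : Disjoint {y} C := Finset.disjoint_singleton_left.2 hyC
    rw [hdec, hφ _ _ _ dxy dxC dyC, hψ _ _ _ dxy dxC dyC,
      smaller _ (Finset.union_subset hxS hyS) ⟨z, hzS, by simp [hzx, hzy]⟩,
      smaller _ (Finset.union_subset hxS hCS) ⟨y, hy, by simp [hxy.symm, hyC]⟩,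
      smaller _ (Finset.union_subset hyS hCS) ⟨x, hx, by simp [hxy, hxC]⟩,
      smaller _ hxS ⟨y, hy, by simp [hxy.symm]⟩,
      smaller _ hyS ⟨x, hx, by simp [hxy]⟩,
      smaller _ hCS ⟨x, hx, hxC⟩]

theorem apply_empty (hφ : Grade2Additive φ) : φ ∅ = 0 := by
  have h := hφ ∅ ∅ ∅ (by simp) (by simp) (by simp)
  simp only [Finset.union_empty] at h
  have two : (2 : ZMod 2) = 0 := by decide
  linear_combination h + 3 * φ ∅ * two

end Grade2Additive

theorem grade2Additive_Pw {Ω : Type*} [DecidableEq Ω] (ω : Ω) (φ : Finset Ω → ZMod 2) :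
    Grade2Additive (Pw ω φ) := by
  convert Grade2Additive.sum_mul_sum (fun j => if j = ω then 1 else 0)
    (fun j => if j = ω then φ {ω} else φ {ω, j} + φ {ω}) using 1
  funext A
  by_cases hω : ω ∈ A
  · rw [← Finset.add_sum_erase A (fun j => if j = ω then φ {ω} else φ {ω, j} + φ {ω}) hω,
      Finset.sum_congr rfl fun j hj => if_neg (Finset.ne_of_mem_erase hj)]
    simp [Pw, hω]
  · simp [Pw, hω]

theorem Pw_apply_of_card_le_two {Ω : Type*} [DecidableEq Ω] (ω : Ω) (φ : Finset Ω → ZMod 2)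
    {S : Finset Ω} (hS : S.card ≤ 2) : Pw ω φ S = if ω ∈ S then φ S else 0 := by
  by_cases hω : ω ∈ S
  · have hcard : (S.erase ω).card ≤ 1 := by
      rw [Finset.card_erase_of_mem hω]
      omega
    simp only [Pw, if_pos hω]
    have : Nonempty Ω := ⟨ω⟩
    obtain ⟨j, hj⟩ := Finset.card_le_one_iff_subset_singleton.1 hcard
    rcases Finset.subset_singleton_iff.1 hj with h | h
    · rw [h, ← Finset.insert_erase hω, h]
      simp
    · rw [h, ← Finset.insert_erase hω, h, Finset.sum_singleton]
      have two : (2 : ZMod 2) = 0 := by decide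
      linear_combination φ {ω} * two
  · simp [Pw, hω]

section masterObservable

variable {Ω : Type*} [LinearOrder Ω]

theorem grade2Additive_masterObservable (A : Finset Ω) (φ : Finset Ω → ZMod 2) :
    Grade2Additive (masterObservable A φ) :=
  (Grade2Additive.sum _ fun _ _ => grade2Additive_Pw _ _).add
    (Grade2Additive.sum _ fun _ _ => grade2Additive_Pw _ _)

/-- On sets with at most two elements, `P(A)` restricts a coevent to the sets meeting `A`. -/
theorem masterObservable_apply_of_card_le_two (A : Finset Ω) (φ : Finset Ω → ZMod 2)
    {S : Finset Ω} (hS : S.card ≤ 2) :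
    masterObservable A φ S = if Disjoint A S then 0 else φ S := by
  have hT : (A ∩ S).card ≤ 2 := (Finset.card_le_card Finset.inter_subset_right).trans hS
  have key : masterObservable A φ S =
      ∑ _x ∈ A ∩ S, φ S + ∑ x ∈ A ∩ S, ∑ y ∈ A ∩ S, if x < y then φ S else 0 := by
    simp only [masterObservable, Pi.add_apply, Finset.sum_apply, Pw_apply_of_card_le_two _ _ hS]
    rw [Finset.sum_filter, Finset.sum_product]
    simp only [← Finset.sum_ite_mem A S]
    congr 1
    refine Finset.sum_congr rfl fun x _ => ?_
    by_cases hx : x ∈ S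
    · simp only [hx, if_true]
      refine Finset.sum_congr rfl fun y _ => ?_
      split_ifs <;> rfl
    · simp [hx]
  rw [key]
  simp only [Finset.disjoint_iff_inter_eq_empty]
  generalize A ∩ S = T at hT
  have two : (2 : ZMod 2) = 0 := by decide
  interval_cases h : T.card
  · simp [Finset.card_eq_zero.1 h]
  · obtain ⟨a, rfl⟩ := Finset.card_eq_one.1 h
    simp
  · obtain ⟨a, b, hab, rfl⟩ := Finset.card_eq_two.1 h
    rcases lt_or_gt_of_ne hab with hlt | hlt
    · simp [Finset.sum_pair hab, hlt, hlt.not_gt]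
      linear_combination φ S * two
    · simp [Finset.sum_pair hab, hlt, hlt.not_gt]
      linear_combination φ S * two

end masterObservable

/-- The master observable satisfies, as maps on the space `𝒜^*` of coevents:
(a) `P(A ∪ B) = P(A) + P(B) + P(A)P(B)`;
(b) `P(Ω) = I`;
(d) grade-2 additivity:
`P(A∪B∪C) = P(A∪B) + P(A∪C) + P(B∪C) + P(A) + P(B) + P(C)` for mutually
disjoint `A, B, C`. -/
theorem statement_17 {Ω : Type*} [Fintype Ω] [LinearOrder Ω] :
    (∀ (A B : Finset Ω) (φ : Finset Ω → ZMod 2), Grade2Additive φ →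
      masterObservable (A ∪ B) φ =
        masterObservable A φ + masterObservable B φ +
          masterObservable A (masterObservable B φ)) ∧
    (∀ φ : Finset Ω → ZMod 2, Grade2Additive φ →
      masterObservable Finset.univ φ = φ) ∧
    (∀ A B C : Finset Ω, Disjoint A B → Disjoint A C → Disjoint B C →
      ∀ φ : Finset Ω → ZMod 2, Grade2Additive φ →
        masterObservable (A ∪ B ∪ C) φ =
          masterObservable (A ∪ B) φ + masterObservable (A ∪ C) φ +
            masterObservable (B ∪ C) φ + masterObservable A φ +
            masterObservable B φ + masterObservable C φ) := by
  refine ⟨fun A B φ _ => ?_, fun φ hφ => ?_, fun A B C hAB hAC hBC φ _ => ?_⟩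
  · refine (grade2Additive_masterObservable _ _).ext_of_card_le_two
      (((grade2Additive_masterObservable _ _).add (grade2Additive_masterObservable _ _)).add
        (grade2Additive_masterObservable _ _)) fun S hS => ?_
    simp only [Pi.add_apply, masterObservable_apply_of_card_le_two _ _ hS,
      Finset.disjoint_union_left]
    by_cases hA : Disjoint A S <;> by_cases hB : Disjoint B S <;>
      simp [hA, hB, CharTwo.add_self_eq_zero]
  · refine (grade2Additive_masterObservable _ _).ext_of_card_le_two hφ fun S hS => ?_
    rw [masterObservable_apply_of_card_le_two _ _ hS]
    rcases S.eq_empty_or_nonempty with rfl | ⟨x, hx⟩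
    · simp [hφ.apply_empty]
    · exact if_neg fun h => Finset.disjoint_left.1 h (Finset.mem_univ x) hx
  · refine (grade2Additive_masterObservable _ _).ext_of_card_le_two
      ((((((grade2Additive_masterObservable _ _).add (grade2Additive_masterObservable _ _)).add
        (grade2Additive_masterObservable _ _)).add (grade2Additive_masterObservable _ _)).add
        (grade2Additive_masterObservable _ _)).add (grade2Additive_masterObservable _ _))
      fun S hS => ?_
    have hmeet : Disjoint A S ∨ Disjoint B S ∨ Disjoint C S := by
      by_contra! h
      obtain ⟨a, haA, haS⟩ := Finset.not_disjoint_iff.1 h.1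
      obtain ⟨b, hbB, hbS⟩ := Finset.not_disjoint_iff.1 h.2.1
      obtain ⟨c, hcC, hcS⟩ := Finset.not_disjoint_iff.1 h.2.2
      have : 2 < S.card := Finset.two_lt_card_iff.2 ⟨a, b, c, haS, hbS, hcS,
        hAB.forall_ne_finset haA hbB, hAC.forall_ne_finset haA hcC,
        hBC.forall_ne_finset hbB hcC⟩
      omega
    simp only [Pi.add_apply, masterObservable_apply_of_card_le_two _ _ hS,
      Finset.disjoint_union_left]
    by_cases hA : Disjoint A S <;> by_cases hB : Disjoint B S <;>
      by_cases hC : Disjoint C S <;> simp [hA, hB, hC, CharTwo.add_self_eq_zero] at hmeet ⊢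
end
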